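/- Let u and ψ(z) = az + b be entire functions on ℂ with |a| = 1, a ≠ 1, such that the weighted composition operator W_{(u,ψ)} is bounded on the Fock space 𝓕₂, let z₀ = b/(1 − a) be the fixed point of ψ, and suppose m ≥ 2 is the smallest integer with a^m = a. Then each of the numbers conj(u(z₀)), conj(a·u(z₀)), conj(a²·u(z₀)), ..., conj(a^{m-1}·u(z₀)) is an eigenvalue of the Hilbert-space adjoint W_{(u,ψ)}*. In particular, if u(z₀) ≠ 0 then W_{(u,ψ)}* has at least two distinct eigenvalues. -/

import Mathlib

open MeasureTheory Finset

/-- Squared Fock-space norm: ‖f‖₂² = (1/π)∫_ℂ |f(z)|² e^{-|z|²} dA(z). -/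
noncomputable def fockNormSq (f : ℂ → ℂ) : ℝ :=
  (1 / Real.pi) * ∫ z : ℂ, ‖f z‖ ^ 2 * Real.exp (-‖z‖ ^ 2)

/-- Membership in the Fock space 𝓕₂: entire and square Gaussian-integrable. -/
def MemFock (f : ℂ → ℂ) : Prop :=
  Differentiable ℂ f ∧
  Integrable (fun z : ℂ => ‖f z‖ ^ 2 * Real.exp (-‖z‖ ^ 2))

/-- Fock-space inner product ⟨f,g⟩ = (1/π)∫_ℂ f(z)·conj(g(z))·e^{-|z|²} dA(z). -/
noncomputable def fockInner (f g : ℂ → ℂ) : ℂ :=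
  (1 / (Real.pi : ℂ)) * ∫ z : ℂ, f z * (starRingEnd ℂ) (g z) * (Real.exp (-‖z‖ ^ 2) : ℂ)

/-- Reproducing kernel of the Fock space: K_w(z) = e^{z·conj(w)}. -/
noncomputable def fockKernel (w : ℂ) : ℂ → ℂ :=
  fun z => Complex.exp (z * (starRingEnd ℂ) w)

/-- Weighted composition operator W_{(u,ψ)} f = u·(f∘ψ). -/
def wComp (u ψ : ℂ → ℂ) (f : ℂ → ℂ) : ℂ → ℂ := fun z => u z * f (ψ z)

/-- Composition operator C_ψ f = f∘ψ. -/
def compOp (ψ : ℂ → ℂ) (f : ℂ → ℂ) : ℂ → ℂ := fun z => f (ψ z)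

/-- Multiplication operator M_u f = u·f. -/
def mulOp (u : ℂ → ℂ) (f : ℂ → ℂ) : ℂ → ℂ := fun z => u z * f z

/-- T maps 𝓕₂ into 𝓕₂ and is bounded there. -/
def FockBoundedOp (T : (ℂ → ℂ) → ℂ → ℂ) : Prop :=
  (∀ f, MemFock f → MemFock (T f)) ∧
  ∃ C : ℝ, 0 ≤ C ∧ ∀ f, MemFock f → fockNormSq (T f) ≤ C * fockNormSq f

/-- f is a cyclic vector for T on 𝓕₂: the linear span of the orbit
{Tⁿ f : n ≥ 0} is dense in 𝓕₂. -/
def IsCyclicVec (T : (ℂ → ℂ) → ℂ → ℂ) (f : ℂ → ℂ) : Prop :=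
  MemFock f ∧ ∀ g, MemFock g → ∀ ε : ℝ, 0 < ε →
    ∃ (n : ℕ) (c : Fin n → ℂ),
      fockNormSq (fun z => (∑ i : Fin n, c i * T^[(i : ℕ)] f z) - g z) < ε

/-- T is cyclic on 𝓕₂. -/
def IsCyclicOp (T : (ℂ → ℂ) → ℂ → ℂ) : Prop := ∃ f, IsCyclicVec T f

/-- T is hypercyclic on 𝓕₂: some orbit {Tⁿ f : n ≥ 0} is dense. -/
def IsHypercyclicOp (T : (ℂ → ℂ) → ℂ → ℂ) : Prop :=
  ∃ f, MemFock f ∧ ∀ g, MemFock g → ∀ ε : ℝ, 0 < ε →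
    ∃ n : ℕ, fockNormSq (fun z => T^[n] f z - g z) < ε

/-- T is supercyclic on 𝓕₂: some projective orbit {λTⁿ f} is dense. -/
def IsSupercyclicOp (T : (ℂ → ℂ) → ℂ → ℂ) : Prop :=
  ∃ f, MemFock f ∧ ∀ g, MemFock g → ∀ ε : ℝ, 0 < ε →
    ∃ (lam : ℂ) (n : ℕ), fockNormSq (fun z => lam * T^[n] f z - g z) < ε

/-- T is invertible as a bounded operator on 𝓕₂. -/
def FockOpInvertible (T : (ℂ → ℂ) → ℂ → ℂ) : Prop :=
  (∀ f, MemFock f → MemFock (T f)) ∧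
  ∃ S : (ℂ → ℂ) → ℂ → ℂ,
    (∀ f, MemFock f → MemFock (S f)) ∧
    (∀ f, MemFock f → S (T f) = f) ∧
    (∀ f, MemFock f → T (S f) = f) ∧
    ∃ C : ℝ, 0 ≤ C ∧ ∀ f, MemFock f → fockNormSq (S f) ≤ C * fockNormSq f

/-- μ is an eigenvalue of the Hilbert-space adjoint W_{(u,ψ)}*, expressed via the
inner product: W* g = μ g for a nonzero g ∈ 𝓕₂, i.e. ⟨Wf, g⟩ = conj(μ)·⟨f, g⟩
for all f ∈ 𝓕₂. -/
def IsAdjointEigenvalue (u ψ : ℂ → ℂ) (μ : ℂ) : Prop :=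
  ∃ g, MemFock g ∧ g ≠ 0 ∧ ∀ f, MemFock f →
    fockInner (wComp u ψ f) g = (starRingEnd ℂ) μ * fockInner f g

lemma measurePreserving_affine {a : ℂ} (ha : ‖a‖ = 1) (b : ℂ) :
    MeasurePreserving (fun z : ℂ => a * z + b) := by
  have h := (rotation (⟨a, by simp [Submonoid.unitSphere, ha]⟩ : Circle)).measurePreserving
  exact (measurePreserving_add_right volume b).comp h

lemma measurableEmbedding_affine {a : ℂ} (ha : ‖a‖ = 1) (b : ℂ) :
    MeasurableEmbedding (fun z : ℂ => a * z + b) := by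
  have ha0 : a ≠ 0 := by rintro rfl; simp at ha
  exact (measurableEmbedding_addRight b).comp (measurableEmbedding_mulLeft₀ ha0)

lemma integral_comp_affine {E : Type*} [NormedAddCommGroup E] [NormedSpace ℝ E] {a : ℂ}
    (ha : ‖a‖ = 1) (b : ℂ) (f : ℂ → E) : ∫ z, f (a * z + b) = ∫ z, f z :=
  (measurePreserving_affine ha b).integral_comp (measurableEmbedding_affine ha b) f

lemma integrable_comp_affine {E : Type*} [NormedAddCommGroup E] {a : ℂ}
    (ha : ‖a‖ = 1) (b : ℂ) {f : ℂ → E} :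
    Integrable (fun z => f (a * z + b)) ↔ Integrable f :=
  (measurePreserving_affine ha b).integrable_comp_emb (measurableEmbedding_affine ha b)

/-- Mean value property of entire functions with respect to the Gaussian weight. -/
lemma integral_entire_mul_gaussian {H : ℂ → ℂ} (hH : Differentiable ℂ H)
    (hint : Integrable (fun z : ℂ => H z * (Real.exp (-‖z‖ ^ 2) : ℂ))) :
    ∫ z : ℂ, H z * (Real.exp (-‖z‖ ^ 2) : ℂ) = H 0 * ∫ z : ℂ, (Real.exp (-‖z‖ ^ 2) : ℂ) := by
  have hnorm (θ : ℝ) : ‖circleMap 0 1 θ‖ = 1 := by simp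
  have hrot (θ : ℝ) : (fun w : ℂ => H (circleMap 0 1 θ * w) * (Real.exp (-‖w‖ ^ 2) : ℂ)) =
      fun w => (fun z : ℂ => H z * (Real.exp (-‖z‖ ^ 2) : ℂ)) (circleMap 0 1 θ * w + 0) := by
    funext w
    simp only [add_zero, norm_mul, hnorm, one_mul]
  have hcont : Continuous (Function.uncurry fun (θ : ℝ) (w : ℂ) =>
      H (circleMap 0 1 θ * w) * (Real.exp (-‖w‖ ^ 2) : ℂ)) := by
    have := hH.continuous
    have := continuous_circleMap 0 1
    simp only [Function.uncurry_def]
    fun_prop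
  have hprod : Integrable (Function.uncurry fun (θ : ℝ) (w : ℂ) =>
      H (circleMap 0 1 θ * w) * (Real.exp (-‖w‖ ^ 2) : ℂ))
      ((volume.restrict (Set.Ioc 0 (2 * Real.pi))).prod volume) := by
    rw [integrable_prod_iff hcont.aestronglyMeasurable]
    constructor
    · refine Filter.Eventually.of_forall fun θ => ?_
      simp only [Function.uncurry_apply_pair]
      rw [hrot]
      exact (integrable_comp_affine (hnorm θ) 0
        (f := fun z : ℂ => H z * (Real.exp (-‖z‖ ^ 2) : ℂ))).2 hint
    · have : (fun θ : ℝ => ∫ w, ‖H (circleMap 0 1 θ * w) * (Real.exp (-‖w‖ ^ 2) : ℂ)‖) =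
          fun _ => ∫ w, ‖H w * (Real.exp (-‖w‖ ^ 2) : ℂ)‖ := by
        funext θ
        rw [← integral_comp_affine (hnorm θ) 0 (fun w => ‖H w * (Real.exp (-‖w‖ ^ 2) : ℂ)‖)]
        simp only [add_zero, norm_mul, hnorm, one_mul]
      simp only [Function.uncurry_apply_pair]
      rw [this]
      exact integrable_const _
  have hswap := integral_integral_swap hprod
  have hleft (θ : ℝ) : ∫ w : ℂ, H (circleMap 0 1 θ * w) * (Real.exp (-‖w‖ ^ 2) : ℂ) =
      ∫ z : ℂ, H z * (Real.exp (-‖z‖ ^ 2) : ℂ) := by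
    rw [hrot]
    exact integral_comp_affine (hnorm θ) 0 (fun z => H z * (Real.exp (-‖z‖ ^ 2) : ℂ))
  have hright (w : ℂ) : ∫ θ in Set.Ioc 0 (2 * Real.pi),
      H (circleMap 0 1 θ * w) * (Real.exp (-‖w‖ ^ 2) : ℂ) =
      (2 * Real.pi : ℂ) * (H 0 * (Real.exp (-‖w‖ ^ 2) : ℂ)) := by
    have hd : Differentiable ℂ (fun ζ => H (ζ * w)) := by fun_prop
    have h := hd.diffContOnCl (s := Metric.ball 0 |(1 : ℝ)|) |>.circleAverage
    rw [Real.circleAverage_def, intervalIntegral.integral_of_le (by positivity),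
      zero_mul, Complex.real_smul] at h
    rw [integral_mul_const, ← h]
    push_cast
    rw [← mul_assoc, ← mul_assoc, mul_inv_cancel₀ (by simp), one_mul]
  simp only [hleft, hright, integral_const] at hswap
  rw [integral_const_mul, integral_const_mul, Complex.real_smul] at hswap
  have hvol : (volume.restrict (Set.Ioc 0 (2 * Real.pi))).real Set.univ = 2 * Real.pi := by
    simp [Measure.real, Real.pi_pos.le]
  rw [hvol] at hswap
  push_cast at hswap
  have hpi : (2 * Real.pi : ℂ) ≠ 0 := by simp [Real.pi_ne_zero]
  simpa using mul_left_cancel₀ hpi hswap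

lemma integrable_gaussian_mul {c : ℝ} (hc : 0 < c) :
    Integrable (fun z : ℂ => Real.exp (-c * ‖z‖ ^ 2)) := by
  have h := (GaussianFourier.integrable_cexp_neg_mul_sq_norm_add (V := ℂ) (b := (c : ℂ))
    (by simpa using hc) 0 0).norm
  refine h.congr (Filter.Eventually.of_forall fun z => ?_)
  simp [Complex.norm_exp, ← Complex.ofReal_pow]

lemma integrable_gaussian : Integrable (fun z : ℂ => Real.exp (-‖z‖ ^ 2)) := by
  simpa using integrable_gaussian_mul one_pos

lemma integral_gaussian_pos : 0 < ∫ z : ℂ, Real.exp (-‖z‖ ^ 2) :=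
  integral_exp_pos integrable_gaussian

lemma norm_sq_mul_integral_gaussian_le {G : ℂ → ℂ} (hG : Differentiable ℂ G)
    (hint : Integrable (fun z : ℂ => ‖G z‖ ^ 2 * Real.exp (-‖z‖ ^ 2))) :
    ‖G 0‖ ^ 2 * ∫ z : ℂ, Real.exp (-‖z‖ ^ 2) ≤
      ∫ z : ℂ, ‖G z‖ ^ 2 * Real.exp (-‖z‖ ^ 2) := by
  have hn (z : ℂ) : ‖G z ^ 2 * (Real.exp (-‖z‖ ^ 2) : ℂ)‖ = ‖G z‖ ^ 2 * Real.exp (-‖z‖ ^ 2) := by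
    rw [norm_mul, norm_pow, Complex.norm_real, Real.norm_eq_abs, Real.abs_exp]
  have hi : Integrable (fun z : ℂ => G z ^ 2 * (Real.exp (-‖z‖ ^ 2) : ℂ)) := by
    have hc := hG.continuous
    refine hint.mono' (by fun_prop) (Filter.Eventually.of_forall fun z => (hn z).le)
  have h := integral_entire_mul_gaussian (hG.pow 2) hi
  calc ‖G 0‖ ^ 2 * ∫ z : ℂ, Real.exp (-‖z‖ ^ 2)
      = ‖∫ z : ℂ, G z ^ 2 * (Real.exp (-‖z‖ ^ 2) : ℂ)‖ := by
        simp only [Pi.pow_apply] at h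
        rw [h, integral_complex_ofReal, norm_mul, norm_pow, Complex.norm_real, Real.norm_eq_abs,
          abs_of_pos integral_gaussian_pos]
    _ ≤ ∫ z : ℂ, ‖G z ^ 2 * (Real.exp (-‖z‖ ^ 2) : ℂ)‖ := norm_integral_le_integral_norm _
    _ = _ := by simp only [hn]

lemma norm_sq_add (p w : ℂ) :
    ‖w + p‖ ^ 2 = ‖w‖ ^ 2 + 2 * (w * (starRingEnd ℂ) p).re + ‖p‖ ^ 2 := by
  simp only [Complex.sq_norm, Complex.normSq_apply, Complex.add_re, Complex.add_im,
    Complex.mul_re, Complex.conj_re, Complex.conj_im]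
  ring

/-- Pointwise evaluation estimate on the Fock space. -/
lemma norm_sq_mul_le_of_memFock {F : ℂ → ℂ} (hF : MemFock F) (p : ℂ) :
    ‖F p‖ ^ 2 * ∫ z : ℂ, Real.exp (-‖z‖ ^ 2) ≤
      Real.exp (‖p‖ ^ 2) * ∫ z : ℂ, ‖F z‖ ^ 2 * Real.exp (-‖z‖ ^ 2) := by
  have hd := hF.1
  have hG : Differentiable ℂ (fun w => F (w + p) * Complex.exp (-(w * (starRingEnd ℂ) p))) := by
    fun_prop
  have key (w : ℂ) :
      ‖F (w + p) * Complex.exp (-(w * (starRingEnd ℂ) p))‖ ^ 2 * Real.exp (-‖w‖ ^ 2) =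
      Real.exp (‖p‖ ^ 2) *
        (fun z : ℂ => ‖F z‖ ^ 2 * Real.exp (-‖z‖ ^ 2)) (1 * w + p) := by
    have e : Real.exp (-(w * (starRingEnd ℂ) p).re) ^ 2 * Real.exp (-‖w‖ ^ 2) =
        Real.exp (‖p‖ ^ 2) * Real.exp (-‖w + p‖ ^ 2) := by
      rw [← Real.exp_nat_mul, ← Real.exp_add, ← Real.exp_add, norm_sq_add]
      congr 1
      push_cast
      ring
    simp only [one_mul]
    rw [norm_mul, Complex.norm_exp, Complex.neg_re, mul_pow, mul_assoc, e]
    ring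
  have h := norm_sq_mul_integral_gaussian_le hG (by
    simp only [key]
    exact ((integrable_comp_affine norm_one p).2 hF.2).const_mul _)
  simp only [key] at h
  rw [integral_const_mul,
    integral_comp_affine norm_one p (fun z => ‖F z‖ ^ 2 * Real.exp (-‖z‖ ^ 2))] at h
  simpa using h

lemma norm_sq_weighted_kernel (p : ℂ) (j : ℕ) (w : ℂ) :
    ‖((w + p) - p) ^ j * Complex.exp ((w + p) * (starRingEnd ℂ) p)‖ ^ 2 *
      Real.exp (-‖w + p‖ ^ 2) =
    Real.exp (‖p‖ ^ 2) * (‖w‖ ^ (2 * j) * Real.exp (-‖w‖ ^ 2)) := by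
  have hp : (p * (starRingEnd ℂ) p).re = ‖p‖ ^ 2 := by
    rw [Complex.mul_conj, Complex.normSq_eq_norm_sq, Complex.ofReal_re]
  have e : Real.exp ((w * (starRingEnd ℂ) p).re + ‖p‖ ^ 2) ^ 2 * Real.exp (-‖w + p‖ ^ 2) =
      Real.exp (‖p‖ ^ 2) * Real.exp (-‖w‖ ^ 2) := by
    rw [← Real.exp_nat_mul, ← Real.exp_add, ← Real.exp_add, norm_sq_add]
    congr 1
    push_cast
    ring
  rw [add_sub_cancel_right, norm_mul, norm_pow, Complex.norm_exp, add_mul, Complex.add_re, hp,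
    mul_pow, mul_assoc, e]
  ring

lemma integrable_norm_pow_mul_gaussian (j : ℕ) :
    Integrable (fun z : ℂ => ‖z‖ ^ (2 * j) * Real.exp (-‖z‖ ^ 2)) := by
  refine ((integrable_gaussian_mul one_half_pos).const_mul (2 ^ j * (j.factorial : ℝ))).mono'
    (by fun_prop) (Filter.Eventually.of_forall fun z => ?_)
  have hx : 0 ≤ ‖z‖ ^ 2 / 2 := by positivity
  have h : (‖z‖ ^ 2 / 2) ^ j / (j.factorial : ℝ) ≤ Real.exp (‖z‖ ^ 2 / 2) :=
    (Finset.single_le_sum (f := fun i : ℕ => (‖z‖ ^ 2 / 2) ^ i / (i.factorial : ℝ))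
      (fun i _ => by positivity) (Finset.self_mem_range_succ j)).trans
      (Real.sum_le_exp_of_nonneg hx (j + 1))
  rw [div_le_iff₀ (by positivity), div_pow, div_le_iff₀ (by positivity), ← pow_mul] at h
  rw [Real.norm_of_nonneg (by positivity)]
  calc ‖z‖ ^ (2 * j) * Real.exp (-‖z‖ ^ 2)
      ≤ (Real.exp (‖z‖ ^ 2 / 2) * j.factorial * 2 ^ j) * Real.exp (-‖z‖ ^ 2) := by gcongr
    _ = 2 ^ j * j.factorial * (Real.exp (‖z‖ ^ 2 / 2) * Real.exp (-‖z‖ ^ 2)) := by ring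
    _ = 2 ^ j * j.factorial * Real.exp (-(1 / 2) * ‖z‖ ^ 2) := by
        rw [← Real.exp_add]
        congr 2
        ring

lemma memFock_weighted_kernel (p : ℂ) (j : ℕ) :
    MemFock (fun z => (z - p) ^ j * fockKernel p z) := by
  refine ⟨by unfold fockKernel; fun_prop, ?_⟩
  rw [← integrable_comp_affine norm_one p]
  simp only [one_mul, fockKernel, norm_sq_weighted_kernel]
  exact (integrable_norm_pow_mul_gaussian j).const_mul _

lemma memFock_fockKernel (p : ℂ) : MemFock (fockKernel p) := by
  simpa using memFock_weighted_kernel p 0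

lemma integral_norm_sq_fockKernel (p : ℂ) :
    ∫ z : ℂ, ‖fockKernel p z‖ ^ 2 * Real.exp (-‖z‖ ^ 2) =
      Real.exp (‖p‖ ^ 2) * ∫ z : ℂ, Real.exp (-‖z‖ ^ 2) := by
  rw [← integral_comp_affine norm_one p, ← integral_const_mul]
  refine integral_congr_ae (Filter.Eventually.of_forall fun w => ?_)
  simpa [fockKernel] using norm_sq_weighted_kernel p 0 w

/-- A bounded weighted composition operator satisfies `‖u z‖² ≤ C exp(‖z‖² - ‖ψ z‖²)`. -/
lemma exists_norm_sq_le_of_bounded {u ψ : ℂ → ℂ} (h : FockBoundedOp (wComp u ψ)) :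
    ∃ C : ℝ, ∀ z, ‖u z‖ ^ 2 ≤ C * Real.exp (‖z‖ ^ 2 - ‖ψ z‖ ^ 2) := by
  obtain ⟨hmem, C, -, hC⟩ := h
  refine ⟨C, fun z => ?_⟩
  have hI := integral_gaussian_pos
  have h1 := norm_sq_mul_le_of_memFock (hmem _ (memFock_fockKernel (ψ z))) z
  have h2 := hC _ (memFock_fockKernel (ψ z))
  rw [fockNormSq, fockNormSq, integral_norm_sq_fockKernel, mul_left_comm,
    mul_le_mul_iff_right₀ (by positivity)] at h2
  have h3 := h1.trans (mul_le_mul_of_nonneg_left h2 (Real.exp_pos _).le)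
  have hk : ‖fockKernel (ψ z) (ψ z)‖ = Real.exp (‖ψ z‖ ^ 2) := by
    rw [fockKernel, Complex.norm_exp, Complex.mul_conj, Complex.normSq_eq_norm_sq,
      Complex.ofReal_re]
  rw [wComp, norm_mul, hk] at h3
  rw [Real.exp_sub, ← mul_div_assoc, le_div_iff₀ (Real.exp_pos _)]
  have hE := Real.exp_pos (‖ψ z‖ ^ 2)
  refine le_of_mul_le_mul_right (a := Real.exp (‖ψ z‖ ^ 2) * ∫ z : ℂ, Real.exp (-‖z‖ ^ 2)) ?_
    (by positivity)
  linarith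

/-- The weight of a bounded weighted composition operator whose symbol is a rotation about `p`. -/
lemma weight_eq_of_bounded {u : ℂ → ℂ} {a b p : ℂ} (hu : Differentiable ℂ u) (ha : ‖a‖ = 1)
    (hp : a * p + b = p) (h : FockBoundedOp (wComp u (fun z => a * z + b))) (w : ℂ) :
    u (w + p) = u p * Complex.exp ((1 - a) * w * (starRingEnd ℂ) p) := by
  obtain ⟨C, hC⟩ := exists_norm_sq_le_of_bounded h
  have hψ (w : ℂ) : a * (w + p) + b = a * w + p := by linear_combination hp
  set v : ℂ → ℂ := fun w => u (w + p) * Complex.exp (-((1 - a) * w * (starRingEnd ℂ) p)) with hv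
  have hvd : Differentiable ℂ v := by fun_prop
  have hvb (w : ℂ) : ‖v w‖ ^ 2 ≤ C := by
    have h1 := hC (w + p)
    rw [hψ, norm_sq_add, norm_sq_add, norm_mul, ha, one_mul] at h1
    rw [hv, norm_mul, Complex.norm_exp, mul_pow, ← Real.exp_nat_mul]
    have h2 := mul_le_mul_of_nonneg_right h1
      (Real.exp_pos (((2 : ℕ) : ℝ) * (-((1 - a) * w * (starRingEnd ℂ) p)).re)).le
    rw [mul_assoc C, ← Real.exp_add] at h2
    refine h2.trans_eq ?_
    rw [show (1 - a) * w * (starRingEnd ℂ) p =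
      w * (starRingEnd ℂ) p - a * w * (starRingEnd ℂ) p by ring, Complex.neg_re, Complex.sub_re]
    convert mul_one C
    rw [Real.exp_eq_one_iff]
    push_cast
    ring
  have hb : Bornology.IsBounded (Set.range v) := by
    refine isBounded_iff_forall_norm_le.2 ⟨Real.sqrt C, ?_⟩
    rintro _ ⟨w, rfl⟩
    exact Real.le_sqrt_of_sq_le (hvb w)
  have hc := hvd.apply_eq_apply_of_bounded hb w 0
  simp only [hv, zero_add, mul_zero, zero_mul, neg_zero, Complex.exp_zero, mul_one] at hc
  rw [← hc, mul_assoc, ← Complex.exp_add, neg_add_cancel, Complex.exp_zero, mul_one]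

/-- Every `conj (a ^ j * u p)` is an eigenvalue of the adjoint, with eigenvector
`z ↦ (z - p) ^ j * exp (z * conj p)`. -/
lemma isAdjointEigenvalue_of_bounded {u : ℂ → ℂ} {a b p : ℂ} (hu : Differentiable ℂ u)
    (ha : ‖a‖ = 1) (hp : a * p + b = p) (h : FockBoundedOp (wComp u (fun z => a * z + b)))
    (j : ℕ) :
    IsAdjointEigenvalue u (fun z => a * z + b) ((starRingEnd ℂ) (a ^ j * u p)) := by
  refine ⟨_, memFock_weighted_kernel p j, ?_, fun f _ => ?_⟩
  · intro h0
    have := congrFun h0 (p + 1)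
    simp [fockKernel] at this
  have haa : a * (starRingEnd ℂ) a = 1 := by
    rw [Complex.mul_conj, Complex.normSq_eq_norm_sq, ha]
    norm_num
  set G : ℂ → ℂ := fun z => (starRingEnd ℂ) ((z - p) ^ j * fockKernel p z) *
    (Real.exp (-‖z‖ ^ 2) : ℂ) with hG
  have hGw (w : ℂ) : G (w + p) = (starRingEnd ℂ) w ^ j *
      Complex.exp (-(w * (starRingEnd ℂ) p) - w * (starRingEnd ℂ) w) := by
    simp only [hG, fockKernel]
    rw [map_mul, map_pow, add_sub_cancel_right, ← Complex.exp_conj, Complex.ofReal_exp, mul_assoc,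
      ← Complex.exp_add]
    congr 2
    push_cast
    rw [← Complex.mul_conj']
    simp only [map_mul, map_add, Complex.conj_conj]
    ring
  have key (z : ℂ) : u z * G z = a ^ j * u p * G (a * z + b) := by
    obtain ⟨w, rfl⟩ : ∃ w, z = w + p := ⟨z - p, by ring⟩
    rw [show a * (w + p) + b = a * w + p by linear_combination hp, hGw, hGw,
      weight_eq_of_bounded hu ha hp h, map_mul]
    have e : Complex.exp ((1 - a) * w * (starRingEnd ℂ) p) *
        Complex.exp (-(w * (starRingEnd ℂ) p) - w * (starRingEnd ℂ) w) =
        Complex.exp (-(a * w * (starRingEnd ℂ) p) -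
          a * w * ((starRingEnd ℂ) a * (starRingEnd ℂ) w)) := by
      rw [← Complex.exp_add]
      congr 1
      linear_combination w * (starRingEnd ℂ) w * haa
    have hj : a ^ j * (starRingEnd ℂ) a ^ j = 1 := by rw [← mul_pow, haa, one_pow]
    rw [← e, mul_pow]
    linear_combination (-(u p) * (starRingEnd ℂ) w ^ j *
      (Complex.exp ((1 - a) * w * (starRingEnd ℂ) p) *
        Complex.exp (-(w * (starRingEnd ℂ) p) - w * (starRingEnd ℂ) w))) * hj
  have hint : ∫ z, wComp u (fun z => a * z + b) f z *
      (starRingEnd ℂ) ((z - p) ^ j * fockKernel p z) * (Real.exp (-‖z‖ ^ 2) : ℂ) =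
      a ^ j * u p * ∫ z, f z * (starRingEnd ℂ) ((z - p) ^ j * fockKernel p z) *
        (Real.exp (-‖z‖ ^ 2) : ℂ) := by
    simp only [mul_assoc (wComp _ _ _ _), mul_assoc (f _)]
    change ∫ z, wComp u (fun z => a * z + b) f z * G z = a ^ j * u p * ∫ z, f z * G z
    rw [← integral_comp_affine ha b (fun z => f z * G z), ← integral_const_mul]
    refine integral_congr_ae (Filter.Eventually.of_forall fun z => ?_)
    simp only [wComp]
    linear_combination f (a * z + b) * key z
  rw [fockInner, fockInner, hint, Complex.conj_conj]
  ring

/-- for ψ(z) = az + b with |a| = 1, a ≠ 1, z₀ = b/(1-a) the fixed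
point of ψ, and m ≥ 2 the smallest integer with a^m = a, each conj(a^j·u(z₀))
for 0 ≤ j ≤ m-1 is an eigenvalue of W_{(u,ψ)}*; in particular if u(z₀) ≠ 0 then
W_{(u,ψ)}* has at least two distinct eigenvalues. -/
theorem adjoint_eigenvalues (u : ℂ → ℂ) (a b z₀ : ℂ)
    (hu : Differentiable ℂ u) (ha1 : ‖a‖ = 1) (ha : a ≠ 1)
    (hbdd : FockBoundedOp (wComp u (fun z => a * z + b)))
    (hz₀ : z₀ = b / (1 - a))
    (m : ℕ) (hm2 : 2 ≤ m) (hma : a ^ m = a)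
    (hmin : ∀ k : ℕ, 2 ≤ k → k < m → a ^ k ≠ a) :
    (∀ j : ℕ, j < m →
      IsAdjointEigenvalue u (fun z => a * z + b)
        ((starRingEnd ℂ) (a ^ j * u z₀))) ∧
    (u z₀ ≠ 0 → ∃ μ₁ μ₂ : ℂ, μ₁ ≠ μ₂ ∧
      IsAdjointEigenvalue u (fun z => a * z + b) μ₁ ∧
      IsAdjointEigenvalue u (fun z => a * z + b) μ₂) := by
  have hp : a * z₀ + b = z₀ := by
    have h1 : 1 - a ≠ 0 := sub_ne_zero.2 ha.symm
    rw [hz₀]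
    field_simp
    ring
  have key := isAdjointEigenvalue_of_bounded hu ha1 hp hbdd
  refine ⟨fun j _ => key j, fun h0 => ⟨_, _, ?_, key 0, key 1⟩⟩
  intro h
  have h2 := (starRingEnd ℂ).injective h
  rw [pow_zero, pow_one] at h2
  exact ha (mul_right_cancel₀ h0 h2).symm
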